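/- Let T_1, …, T_d be bounded operators on H. Then the reconstruction operator C_T is a well-defined bounded operator on ℓ²(W_d, H) and ‖C_T‖ = ‖T̃‖, where T̃ is the row operator of T; equivalently ‖C_T‖² = ‖Σ_{i=1}^d T_i T_i*‖. In particular, C_T is a contraction if and only if T is a row contraction (this is the isometric property of the Morita transform, applied to the canonical stabilization of the correspondence (ℂ^d, ℂ)). -/

import Mathlib

open ContinuousLinearMap

/-- The row operator `T̃ : H^d → H`, `T̃((h_i)_i) = ∑ i, T i h_i`, on the
ℓ²-direct sum `H^d = PiLp 2 (fun _ : Fin d => H)`. -/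
noncomputable def rowOp {H : Type*} [NormedAddCommGroup H] [InnerProductSpace ℂ H]
    {d : ℕ} (T : Fin d → H →L[ℂ] H) : (PiLp 2 fun _ : Fin d => H) →L[ℂ] H :=
  ∑ i, (T i).comp (PiLp.proj 2 (fun _ : Fin d => H) i)

/-- `ℓ²(W_d, H)`: the Hilbert space of square-summable `H`-valued functions on the
set `W_d = List (Fin d)` of finite words in the alphabet `{1, …, d}`; unitarily
this is `ℱ(ℂ^d) ⊗ H`. -/
noncomputable abbrev FockH (d : ℕ) (H : Type*) [NormedAddCommGroup H] : Type _ :=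
  lp (fun _ : List (Fin d) => H) 2

section RowOperator

variable {H : Type*} [NormedAddCommGroup H] [InnerProductSpace ℂ H] [CompleteSpace H]
  {d : ℕ} (T : Fin d → H →L[ℂ] H)

theorem adjoint_rowOp_apply (h : H) (i : Fin d) :
    adjoint (rowOp T) h i = adjoint (T i) h := by
  refine ext_inner_left ℂ fun k => ?_
  have key := adjoint_inner_right (rowOp T) (PiLp.single 2 i k) h
  have hrow : rowOp T (PiLp.single 2 i k) = T i k := by
    simp only [rowOp, sum_apply, comp_apply]
    rw [Finset.sum_eq_single i]
    · simp
    · intro j _ hj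
      simp [hj]
    · simp
  have hinner : inner ℂ (PiLp.single 2 i k : PiLp 2 fun _ : Fin d => H) (adjoint (rowOp T) h) =
      inner ℂ k (adjoint (rowOp T) h i) := by
    rw [PiLp.inner_apply, Finset.sum_eq_single i]
    · simp
    · intro j _ hj
      simp [hj]
    · simp
  rw [← hinner, key, hrow, adjoint_inner_right]

theorem norm_sq_adjoint_rowOp_apply (h : H) :
    ‖adjoint (rowOp T) h‖ ^ 2 = ∑ i, ‖adjoint (T i) h‖ ^ 2 := by
  rw [PiLp.norm_sq_eq_of_L2]
  simp only [adjoint_rowOp_apply]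

theorem rowOp_comp_adjoint :
    rowOp T ∘L adjoint (rowOp T) = ∑ i, T i ∘L adjoint (T i) := by
  ext h
  simp only [← adjoint_rowOp_apply T h, rowOp, sum_apply, comp_apply, PiLp.proj_apply]

theorem norm_sq_rowOp : ‖rowOp T‖ ^ 2 = ‖∑ i, T i ∘L adjoint (T i)‖ := by
  have := norm_adjoint_comp_self (adjoint (rowOp T))
  rw [adjoint_adjoint, LinearIsometryEquiv.norm_map, rowOp_comp_adjoint] at this
  rw [this, sq]

theorem sum_comp_adjoint_nonneg : 0 ≤ ∑ i, T i ∘L adjoint (T i) :=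
  Finset.sum_nonneg fun i _ => mul_star_self_nonneg (T i)

end RowOperator

section Reconstruction

variable {H : Type*} [NormedAddCommGroup H] {d : ℕ}

theorem FockH.hasSum_norm_sq (ξ : FockH d H) :
    HasSum (fun w : List (Fin d) => ‖ξ w‖ ^ 2) (‖ξ‖ ^ 2) := by
  simpa using lp.hasSum_norm (p := 2) (by norm_num) ξ

theorem append_singleton_injective (α : Type*) :
    Function.Injective fun x : List α × α => x.1 ++ [x.2] := by
  rintro ⟨v, a⟩ ⟨w, b⟩ h
  simpa using h

variable [InnerProductSpace ℂ H] [CompleteSpace H] (T : Fin d → H →L[ℂ] H)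

/-- The function `w·i ↦ T_i* (ξ w)`, `∅ ↦ 0` on words. -/
noncomputable def reconstructionFun (ξ : List (Fin d) → H) (w : List (Fin d)) : H :=
  if h : w = [] then 0 else adjoint (T (w.getLast h)) (ξ w.dropLast)

@[simp]
theorem reconstructionFun_nil (ξ : List (Fin d) → H) : reconstructionFun T ξ [] = 0 := by
  simp [reconstructionFun]

@[simp]
theorem reconstructionFun_append (ξ : List (Fin d) → H) (w : List (Fin d)) (i : Fin d) :
    reconstructionFun T ξ (w ++ [i]) = adjoint (T i) (ξ w) := by
  simp [reconstructionFun]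

theorem summable_norm_sq_adjoint_rowOp (ξ : FockH d H) :
    Summable fun w : List (Fin d) => ‖adjoint (rowOp T) (ξ w)‖ ^ 2 := by
  refine Summable.of_nonneg_of_le (fun _ => by positivity) (fun w => ?_)
    ((FockH.hasSum_norm_sq ξ).summable.mul_left (‖adjoint (rowOp T)‖ ^ 2))
  rw [← mul_pow]
  gcongr
  exact le_opNorm _ _

theorem hasSum_norm_sq_reconstructionFun (ξ : FockH d H) :
    HasSum (fun w => ‖reconstructionFun T ξ w‖ ^ 2)
      (∑' w : List (Fin d), ‖adjoint (rowOp T) (ξ w)‖ ^ 2) := by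
  rw [← (append_singleton_injective (Fin d)).hasSum_iff]
  · have hs : Summable fun x : List (Fin d) × Fin d => ‖adjoint (T x.2) (ξ x.1)‖ ^ 2 := by
      rw [summable_prod_of_nonneg fun _ => by positivity]
      refine ⟨fun _ => Summable.of_finite, ?_⟩
      simpa only [tsum_fintype, ← norm_sq_adjoint_rowOp_apply]
        using summable_norm_sq_adjoint_rowOp T ξ
    have ht := hs.hasSum
    rw [hs.tsum_prod] at ht
    simpa only [tsum_fintype, ← norm_sq_adjoint_rowOp_apply, Function.comp_def,
      reconstructionFun_append] using ht
  · intro w hw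
    rcases List.eq_nil_or_concat w with rfl | ⟨v, i, rfl⟩
    · simp
    · exact absurd ⟨(v, i), by simp⟩ hw

theorem memℓp_reconstructionFun (ξ : FockH d H) :
    Memℓp (E := fun _ => H) (reconstructionFun T ξ) 2 :=
  memℓp_gen <| by simpa using (hasSum_norm_sq_reconstructionFun T ξ).summable

/-- The reconstruction operator as a linear map on `ℓ²(W_d, H)`. -/
noncomputable def reconstructionLinear : FockH d H →ₗ[ℂ] FockH d H where
  toFun ξ := ⟨reconstructionFun T ξ, memℓp_reconstructionFun T ξ⟩
  map_add' ξ η := by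
    ext w
    change reconstructionFun T (⇑ξ + ⇑η) w = reconstructionFun T ξ w + reconstructionFun T η w
    rcases List.eq_nil_or_concat w with rfl | ⟨v, i, rfl⟩ <;> simp
  map_smul' c ξ := by
    ext w
    change reconstructionFun T (c • ⇑ξ) w = c • reconstructionFun T ξ w
    rcases List.eq_nil_or_concat w with rfl | ⟨v, i, rfl⟩ <;> simp

theorem norm_sq_reconstructionLinear (ξ : FockH d H) :
    ‖reconstructionLinear T ξ‖ ^ 2 =
      ∑' w : List (Fin d), ‖adjoint (rowOp T) (ξ w)‖ ^ 2 :=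
  (FockH.hasSum_norm_sq (reconstructionLinear T ξ)).unique
    (hasSum_norm_sq_reconstructionFun T ξ)

theorem norm_reconstructionLinear_le (ξ : FockH d H) :
    ‖reconstructionLinear T ξ‖ ≤ ‖rowOp T‖ * ‖ξ‖ := by
  refine le_of_sq_le_sq ?_ (by positivity)
  rw [norm_sq_reconstructionLinear, mul_pow, ← (FockH.hasSum_norm_sq ξ).tsum_eq,
    ← tsum_mul_left]
  refine (summable_norm_sq_adjoint_rowOp T ξ).tsum_le_tsum (fun w => ?_)
    ((FockH.hasSum_norm_sq ξ).summable.mul_left _)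
  rw [← mul_pow, ← LinearIsometryEquiv.norm_map adjoint (rowOp T)]
  gcongr
  exact le_opNorm _ _

theorem norm_reconstructionLinear_single_nil (h : H) :
    ‖reconstructionLinear T (lp.single 2 ([] : List (Fin d)) h)‖ = ‖adjoint (rowOp T) h‖ := by
  rw [← sq_eq_sq₀ (norm_nonneg _) (norm_nonneg _), norm_sq_reconstructionLinear,
    tsum_eq_single []]
  · simp
  · intro w hw
    simp [hw]

/-- The reconstruction operator `C_T` as a bounded operator on `ℓ²(W_d, H)`. -/
noncomputable def reconstructionOp : FockH d H →L[ℂ] FockH d H :=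
  (reconstructionLinear T).mkContinuous ‖rowOp T‖ (norm_reconstructionLinear_le T)

theorem norm_reconstructionOp : ‖reconstructionOp T‖ = ‖rowOp T‖ := by
  refine le_antisymm (LinearMap.mkContinuous_norm_le _ (norm_nonneg (rowOp T)) _) ?_
  rw [← LinearIsometryEquiv.norm_map adjoint (rowOp T)]
  refine opNorm_le_bound _ (norm_nonneg _) fun h => ?_
  rw [← norm_reconstructionLinear_single_nil]
  refine (le_opNorm (reconstructionOp T) _).trans_eq ?_
  rw [lp.norm_single (by norm_num)]

end Reconstruction

/-- The reconstruction operator `C_T = ∑ i, R_i ⊗ T_i*` is a well-defined bounded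
operator on `ℓ²(W_d, H)`, with `(C_T ξ)(w·i) = T_i*(ξ(w))` and `(C_T ξ)(∅) = 0`,
and `‖C_T‖ = ‖T̃‖`; equivalently `‖C_T‖² = ‖∑ T_i T_i*‖`.  In particular `C_T` is a
contraction iff `T` is a row contraction. -/
theorem reconstruction_operator_exists_norm_eq
    {H : Type*} [NormedAddCommGroup H] [InnerProductSpace ℂ H] [CompleteSpace H]
    {d : ℕ} (hd : 0 < d) (T : Fin d → H →L[ℂ] H) :
    ∃ C : FockH d H →L[ℂ] FockH d H,
      (∀ (ξ : FockH d H) (w : List (Fin d)) (i : Fin d),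
        C ξ (w ++ [i]) = adjoint (T i) (ξ w)) ∧
      (∀ ξ : FockH d H, C ξ ([] : List (Fin d)) = 0) ∧
      ‖C‖ = ‖rowOp T‖ ∧
      ‖C‖ ^ 2 = ‖∑ i, T i ∘L adjoint (T i)‖ ∧
      (‖C‖ ≤ 1 ↔ ∑ i, T i ∘L adjoint (T i) ≤ 1) := by
  have hsq := norm_sq_rowOp T
  refine ⟨reconstructionOp T, fun ξ => reconstructionFun_append T ξ,
    fun ξ => reconstructionFun_nil T ξ, norm_reconstructionOp T, ?_, ?_⟩
  · rw [norm_reconstructionOp, hsq]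
  · rw [norm_reconstructionOp, ← CStarAlgebra.norm_le_one_iff_of_nonneg _
      (sum_comp_adjoint_nonneg T), ← hsq, sq_le_one_iff₀ (norm_nonneg (rowOp T))]
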